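/- arXiv:2309.02898 — 6 statements merged into one kernel-verified Lean document; each statement's English description precedes it below -/
import Mathlib

section
/- Let k ≥ 2 and let ψ : X_k → ℝ be Z_k-invariant. Then there exists an S_k-invariant function φ : (ℝ²)^k → ℝ such that ψ(x) = φ(ρ(x)) for all x ∈ X_k. -/
/-- Action of a permutation `g` on tuples: `(g · x)_i = x_{g i}`. -/
def permAct {ι α : Type*} (g : Equiv.Perm ι) (x : ι → α) : ι → α := fun i => x (g i)

/-- `Z_k`: the cyclic subgroup of `S_k` generated by the cyclic shift `τ`. -/
def Zsub (k : ℕ) : Subgroup (Equiv.Perm (Fin k)) := Subgroup.zpowers (finRotate k)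

/-- `ρ(x)_i = (x_i, x_{τ(i)})`. -/
def rhoZ (k : ℕ) (x : Fin k → ℝ) : Fin k → ℝ × ℝ := fun i => (x i, x (finRotate k i))

/-- `X_k`: points of `[0,1]^k` with pairwise distinct coordinates. -/
def Xset (k : ℕ) : Set (Fin k → ℝ) :=
  {x | (∀ i, x i ∈ Set.Icc (0 : ℝ) 1) ∧ Function.Injective x}

theorem permAct_permAct {ι α : Type*} (g h : Equiv.Perm ι) (x : ι → α) :
    permAct g (permAct h x) = permAct (h * g) x := rfl

/-- The centralizer of a permutation all of whose points lie in one cycle is generated by it. -/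
theorem Equiv.Perm.mem_zpowers_of_commute_of_forall_sameCycle {ι : Type*} {c g : Equiv.Perm ι}
    (a : ι) (hc : ∀ i, c.SameCycle a i) (h : Commute g c) : g ∈ Subgroup.zpowers c := by
  obtain ⟨m, hm⟩ := hc (g a)
  refine ⟨m, Equiv.ext fun i => ?_⟩
  obtain ⟨j, rfl⟩ := hc i
  have hgj : g ((c ^ j) a) = (c ^ j) (g a) := congrArg (· a) (h.zpow_right j).eq
  change (c ^ m) ((c ^ j) a) = g ((c ^ j) a)
  rw [hgj, ← hm, ← Equiv.Perm.mul_apply, ← Equiv.Perm.mul_apply, ← zpow_add, ← zpow_add,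
    add_comm]

theorem mem_Zsub_of_commute_finRotate {k : ℕ} (hk : 2 ≤ k) {g : Equiv.Perm (Fin k)}
    (h : Commute g (finRotate k)) : g ∈ Zsub k := by
  obtain ⟨n, rfl⟩ := Nat.exists_eq_add_of_le' hk
  have hne (i : Fin (n + 2)) : finRotate (n + 2) i ≠ i :=
    Equiv.Perm.mem_support.1 (support_finRotate (n := n) ▸ Finset.mem_univ i)
  exact Equiv.Perm.mem_zpowers_of_commute_of_forall_sameCycle 0
    (fun i => isCycle_finRotate.sameCycle (hne 0) (hne i)) h

/-- If `ρ(y)` is a rearrangement of `ρ(x)` and `x` has distinct coordinates, then `y` is a cyclic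
shift of `x`. -/
theorem exists_mem_Zsub_of_rhoZ_eq_permAct {k : ℕ} (hk : 2 ≤ k) {x y : Fin k → ℝ}
    (hx : Function.Injective x) {g : Equiv.Perm (Fin k)} (h : rhoZ k y = permAct g (rhoZ k x)) :
    ∃ z ∈ Zsub k, y = permAct z x := by
  have hfst (i : Fin k) : y i = x (g i) := congrArg Prod.fst (congrFun h i)
  have hsnd (i : Fin k) : y (finRotate k i) = x (finRotate k (g i)) :=
    congrArg Prod.snd (congrFun h i)
  exact ⟨g, mem_Zsub_of_commute_finRotate hk
    (Equiv.ext fun i => hx ((hfst _).symm.trans (hsnd i))), funext hfst⟩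

/-- `x` is a point of `X_k` such that `A` is a rearrangement of `ρ(x)`. -/
def IsRhoPreimage (k : ℕ) (A : Fin k → ℝ × ℝ) (x : Fin k → ℝ) : Prop :=
  x ∈ Xset k ∧ ∃ g : Equiv.Perm (Fin k), A = permAct g (rhoZ k x)

theorem isRhoPreimage_permAct {k : ℕ} (g : Equiv.Perm (Fin k)) (A : Fin k → ℝ × ℝ) :
    IsRhoPreimage k (permAct g A) = IsRhoPreimage k A := by
  funext x
  refine propext (and_congr_right fun _ => ⟨?_, ?_⟩)
  · rintro ⟨h, hh⟩
    refine ⟨h * g⁻¹, ?_⟩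
    rw [← permAct_permAct, ← hh, permAct_permAct, mul_inv_cancel]
    rfl
  · rintro ⟨h, rfl⟩
    exact ⟨h * g, permAct_permAct _ _ _⟩

/-- Any `Z_k`-invariant `ψ : X_k → ℝ` factors as `ψ = φ ∘ ρ` with `φ` an
`S_k`-invariant function on `(ℝ²)^k`. -/
theorem stmt_0 (k : ℕ) (hk : 2 ≤ k) (ψ : (Fin k → ℝ) → ℝ)
    (hψ : ∀ h ∈ Zsub k, ∀ x ∈ Xset k, ψ (permAct h x) = ψ x) :
    ∃ φ : (Fin k → ℝ × ℝ) → ℝ,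
      (∀ (g : Equiv.Perm (Fin k)) (A : Fin k → ℝ × ℝ), φ (permAct g A) = φ A) ∧
      ∀ x ∈ Xset k, ψ x = φ (rhoZ k x) := by
  refine ⟨fun A => ψ (Classical.epsilon (IsRhoPreimage k A)), fun g A => ?_, fun x hx => ?_⟩
  · simp only [isRhoPreimage_permAct]
  · obtain ⟨hy, g, hg⟩ : IsRhoPreimage k (rhoZ k x)
        (Classical.epsilon (IsRhoPreimage k (rhoZ k x))) :=
      Classical.epsilon_spec ⟨x, hx, 1, rfl⟩
    obtain ⟨z, hz, hxz⟩ := exists_mem_Zsub_of_rhoZ_eq_permAct hk hy.2 hg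
    exact (congrArg ψ hxz).trans (hψ z hz _ hy)
end

section
/- Let k ≥ 2, let x ∈ X_k and let g ∈ S_k act on (ℝ²)^k by permuting the k pair-coordinates. Then g·ρ(x) ∈ ρ(X_k) if and only if there exists h ∈ Z_k such that g·ρ(x) = h·ρ(x). -/
/-- A permutation commuting with a transitive permutation `f` is a power of `f`. -/
theorem mem_zpowers_of_commute_of_sameCycle {ι : Type*} [Nonempty ι] {f g : Equiv.Perm ι}
    (hf : ∀ a b, f.SameCycle a b) (hgf : Commute g f) : g ∈ Subgroup.zpowers f := by
  obtain ⟨a⟩ := ‹Nonempty ι›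
  obtain ⟨n, hn⟩ := hf a (g a)
  refine ⟨n, Equiv.ext fun b => ?_⟩
  obtain ⟨m, rfl⟩ := hf a b
  change (f ^ n * f ^ m) a = (g * f ^ m) a
  rw [(hgf.zpow_right m).eq, ← zpow_add, add_comm, zpow_add, Equiv.Perm.mul_apply, hn,
    Equiv.Perm.mul_apply]

theorem sameCycle_finRotate {k : ℕ} (hk : 2 ≤ k) (a b : Fin k) :
    (finRotate k).SameCycle a b := by
  have hmem (i : Fin k) : finRotate k i ≠ i := by
    rw [← Equiv.Perm.mem_support, support_finRotate_of_le hk]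
    exact Finset.mem_univ i
  exact (isCycle_finRotate_of_le hk).sameCycle (hmem a) (hmem b)

theorem permAct_mem_Xset {k : ℕ} {x : Fin k → ℝ} (hx : x ∈ Xset k) (g : Equiv.Perm (Fin k)) :
    permAct g x ∈ Xset k :=
  ⟨fun i => hx.1 (g i), hx.2.comp g.injective⟩

theorem permAct_rhoZ_of_commute {k : ℕ} (x : Fin k → ℝ) {g : Equiv.Perm (Fin k)}
    (hg : Commute g (finRotate k)) : permAct g (rhoZ k x) = rhoZ k (permAct g x) :=
  funext fun i => Prod.ext rfl (congrArg x (Equiv.congr_fun hg.eq i).symm)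

theorem commute_finRotate_of_permAct_rhoZ_eq {k : ℕ} {x y : Fin k → ℝ}
    (hx : Function.Injective x) {g : Equiv.Perm (Fin k)}
    (h : rhoZ k y = permAct g (rhoZ k x)) : Commute g (finRotate k) := by
  refine Equiv.ext fun i => hx ?_
  exact (congrArg Prod.fst (congrFun h (finRotate k i))).symm.trans
    (congrArg Prod.snd (congrFun h i))

/-- For `x ∈ X_k` and `g ∈ S_k`: `g·ρ(x) ∈ ρ(X_k)` iff `g·ρ(x) = h·ρ(x)`
for some `h ∈ Z_k`. -/
theorem stmt_4 (k : ℕ) (hk : 2 ≤ k) (x : Fin k → ℝ) (hx : x ∈ Xset k)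
    (g : Equiv.Perm (Fin k)) :
    permAct g (rhoZ k x) ∈ rhoZ k '' Xset k ↔
      ∃ h ∈ Zsub k, permAct g (rhoZ k x) = permAct h (rhoZ k x) := by
  constructor
  · rintro ⟨y, -, hy⟩
    have : Nonempty (Fin k) := ⟨⟨0, by omega⟩⟩
    exact ⟨g, mem_zpowers_of_commute_of_sameCycle (sameCycle_finRotate hk)
      (commute_finRotate_of_permAct_rhoZ_eq hx.2 hy), rfl⟩
  · rintro ⟨h, ⟨n, rfl⟩, hgh⟩
    rw [hgh]
    exact ⟨_, permAct_mem_Xset hx _,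
      (permAct_rhoZ_of_commute x ((Commute.refl (finRotate k)).zpow_left n)).symm⟩
end

section
/- Let k ≥ 3 and let ψ : X_k → ℝ be D_k-invariant. Then there exists a function φ : (ℝ²)^{2k} → ℝ invariant under all permutations of the 2k pair-coordinates (i.e., S_{2k}-invariant) such that ψ(x) = φ(ρ_D(x)) for all x ∈ X_k. -/
/-- `D_k`: the dihedral subgroup of `S_k` generated by the cyclic shift `τ`
and the reversal `r(i) = k - i + 1`. -/
def Dsub (k : ℕ) : Subgroup (Equiv.Perm (Fin k)) :=
  Subgroup.closure {finRotate k, Fin.revPerm}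

/-- Index `i ∈ [k]` associated with a position `j ∈ [2k]` (positions `2i-1, 2i`). -/
def halfIdx {k : ℕ} (j : Fin (2 * k)) : Fin k := ⟨j.val / 2, by have := j.isLt; omega⟩

/-- `ρ_D(x)_{2i-1} = (x_i, x_{τ(i)})` and `ρ_D(x)_{2i} = (x_{τ(i)}, x_i)`. -/
def rhoD (k : ℕ) (x : Fin k → ℝ) : Fin (2 * k) → ℝ × ℝ := fun j =>
  if j.val % 2 = 0 then (x (halfIdx j), x (finRotate k (halfIdx j)))
  else (x (finRotate k (halfIdx j)), x (halfIdx j))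

open scoped Fin.CommRing in
/-- Translations of `Fin (n + 1)` belong to the dihedral group. -/
theorem addRight_mem_Dsub {n : ℕ} (a : Fin (n + 1)) : Equiv.addRight a ∈ Dsub (n + 1) := by
  induction a using Fin.induction with
  | zero =>
    convert (Dsub (n + 1)).one_mem
    ext i
    simp
  | succ i ih =>
    have h : Equiv.addRight i.succ = finRotate (n + 1) * Equiv.addRight i.castSucc := by
      ext j : 1
      rw [Equiv.Perm.mul_apply, finRotate_apply, Equiv.coe_addRight, Equiv.coe_addRight,
        add_assoc, Fin.coeSucc_eq_succ]
    rw [h]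
    exact mul_mem (Subgroup.subset_closure (by simp)) ih

open scoped Fin.CommRing in
/-- Reflections of `Fin (n + 1)` belong to the dihedral group. -/
theorem subLeft_mem_Dsub {n : ℕ} (a : Fin (n + 1)) : Equiv.subLeft a ∈ Dsub (n + 1) := by
  have h : Equiv.subLeft a = Equiv.addRight (a + 1) * Fin.revPerm := by
    ext i : 1
    rw [Equiv.Perm.mul_apply, Fin.revPerm_apply, ← Fin.last_sub, Equiv.coe_addRight,
      Equiv.subLeft_apply]
    linear_combination -(Fin.last_add_one n)
  rw [h]
  exact mul_mem (addRight_mem_Dsub _) (Subgroup.subset_closure (by simp))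

/-- The entries of `rhoD` are the edges of the cycle `x`, in both orientations. -/
theorem mem_range_rhoD {n : ℕ} {x : Fin (n + 1) → ℝ} {p : ℝ × ℝ} :
    p ∈ Set.range (rhoD (n + 1) x) ↔
      ∃ i, p = (x i, x (i + 1)) ∨ p = (x (i + 1), x i) := by
  constructor
  · rintro ⟨j, rfl⟩
    refine ⟨halfIdx j, ?_⟩
    unfold rhoD
    rw [finRotate_apply]
    split_ifs <;> simp
  · rintro ⟨i, rfl | rfl⟩
    · refine ⟨⟨2 * i, by omega⟩, ?_⟩
      have h : halfIdx (⟨2 * i, by omega⟩ : Fin (2 * (n + 1))) = i := by ext; simp [halfIdx]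
      simp [rhoD, h, finRotate_apply]
    · refine ⟨⟨2 * i + 1, by omega⟩, ?_⟩
      have h : halfIdx (⟨2 * i + 1, by omega⟩ : Fin (2 * (n + 1))) = i := by
        ext; simp only [halfIdx]; omega
      simp [rhoD, h, finRotate_apply]

open scoped Fin.CommRing in
/-- An injective walk along a cycle that starts in direction `s = ± 1` never turns around. -/
theorem walk_eq_of_start {α : Type*} {n : ℕ} (hn : 2 ≤ n) {x y : Fin (n + 1) → α}
    (hy : Function.Injective y)
    (hadj : ∀ i b, y i = x b → y (i + 1) = x (b + 1) ∨ y (i + 1) = x (b - 1))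
    {a s : Fin (n + 1)} (hs : s = 1 ∨ s = -1) (h₀ : y 0 = x a) (h₁ : y 1 = x (a + s))
    (i : Fin (n + 1)) : y i = x (a + s * i) := by
  have two_ne : (1 + 1 : Fin (n + 1)) ≠ 0 := by
    obtain ⟨m, rfl⟩ := Nat.exists_eq_add_of_le' hn
    intro h
    have := congrArg Fin.val h
    simp [Fin.val_add, Nat.mod_eq_of_lt (show 2 < m + 2 + 1 by omega)] at this
  have key : ∀ j : ℕ, y j = x (a + s * j) ∧ y (j + 1) = x (a + s * (j + 1)) := by
    intro j
    induction j with
    | zero => simpa using ⟨h₀, h₁⟩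
    | succ j ih =>
      obtain ⟨ih₀, ih₁⟩ := ih
      push_cast
      refine ⟨ih₁, ?_⟩
      have hback : y (j + 1 + 1) ≠ x (a + s * j) := by
        rw [← ih₀]
        intro h
        apply two_ne
        linear_combination hy h
      rcases hs with rfl | rfl
      · rcases hadj _ _ ih₁ with h | h
        · rw [h]; congr 1; ring
        · exact absurd (h.trans (congrArg x (by ring))) hback
      · rcases hadj _ _ ih₁ with h | h
        · exact absurd (h.trans (congrArg x (by ring))) hback
        · rw [h]; congr 1; ring
  simpa using (key i).1

open scoped Fin.CommRing in
/-- The set of oriented edges determines an injective cycle up to the dihedral group. -/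
theorem exists_mem_Dsub_of_range_rhoD_eq {n : ℕ} (hn : 2 ≤ n) {x y : Fin (n + 1) → ℝ}
    (hx : Function.Injective x) (hy : Function.Injective y)
    (h : Set.range (rhoD (n + 1) x) = Set.range (rhoD (n + 1) y)) :
    ∃ g ∈ Dsub (n + 1), permAct g x = y := by
  have hedge : ∀ i, ∃ c, (y i = x c ∧ y (i + 1) = x (c + 1)) ∨
      (y i = x (c + 1) ∧ y (i + 1) = x c) := by
    intro i
    have hi : (y i, y (i + 1)) ∈ Set.range (rhoD (n + 1) x) :=
      h ▸ mem_range_rhoD.2 ⟨i, Or.inl rfl⟩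
    simpa only [Prod.mk.injEq] using mem_range_rhoD.1 hi
  have hadj : ∀ i b, y i = x b → y (i + 1) = x (b + 1) ∨ y (i + 1) = x (b - 1) := by
    intro i b hb
    obtain ⟨c, ⟨h₁, h₂⟩ | ⟨h₁, h₂⟩⟩ := hedge i
    · obtain rfl := hx (hb.symm.trans h₁)
      exact Or.inl h₂
    · obtain rfl := hx (hb.symm.trans h₁)
      right
      rwa [add_sub_cancel_right]
  obtain ⟨a, ha⟩ : ∃ a, y 0 = x a := by
    obtain ⟨c, ⟨h₁, -⟩ | ⟨h₁, -⟩⟩ := hedge 0 <;> exact ⟨_, h₁⟩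
  rcases hadj 0 a ha with h₁ | h₁ <;> rw [zero_add] at h₁
  · refine ⟨_, addRight_mem_Dsub a, funext fun i => ?_⟩
    rw [walk_eq_of_start hn hy hadj (Or.inl rfl) ha h₁ i, permAct, Equiv.coe_addRight]
    congr 1
    ring
  · rw [sub_eq_add_neg] at h₁
    refine ⟨_, subLeft_mem_Dsub a, funext fun i => ?_⟩
    rw [walk_eq_of_start hn hy hadj (Or.inr rfl) ha h₁ i, permAct, Equiv.subLeft_apply]
    congr 1
    ring


/-- Any `D_k`-invariant `ψ : X_k → ℝ` factors as `ψ = φ ∘ ρ_D` with `φ` an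
`S_{2k}`-invariant function on `(ℝ²)^{2k}`. -/
theorem stmt_6 (k : ℕ) (hk : 3 ≤ k) (ψ : (Fin k → ℝ) → ℝ)
    (hψ : ∀ h ∈ Dsub k, ∀ x ∈ Xset k, ψ (permAct h x) = ψ x) :
    ∃ φ : (Fin (2 * k) → ℝ × ℝ) → ℝ,
      (∀ (g : Equiv.Perm (Fin (2 * k))) (A : Fin (2 * k) → ℝ × ℝ),
        φ (permAct g A) = φ A) ∧
      ∀ x ∈ Xset k, ψ x = φ (rhoD k x) := by
  obtain ⟨n, rfl⟩ := Nat.exists_eq_add_of_le' (Nat.one_le_of_lt hk)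
  have hfac : Function.FactorsThrough (fun x : Xset (n + 1) => ψ x)
      (fun x : Xset (n + 1) => Set.range (rhoD (n + 1) x)) := by
    intro x y hxy
    obtain ⟨g, hg, hgy⟩ :=
      exists_mem_Dsub_of_range_rhoD_eq (by omega) x.2.2 y.2.2 hxy
    exact (hgy ▸ hψ g hg x x.2).symm
  refine ⟨fun A => Function.extend (fun x : Xset (n + 1) => Set.range (rhoD (n + 1) x))
    (fun x => ψ x) 0 (Set.range A), fun g A => ?_, fun x hx => ?_⟩
  · have hrange : Set.range (permAct g A) = Set.range A := g.surjective.range_comp A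
    simp only [hrange]
  · exact (hfac.extend_apply 0 ⟨x, hx⟩).symm
end

section
/- Let k ≥ 3. The map ρ_D : ℝ^k → (ℝ²)^{2k} is injective, and for every h ∈ D_k and every x ∈ ℝ^k there exists g ∈ S_{2k} (acting by permuting the 2k pair-coordinates) such that ρ_D(h·x) = g·ρ_D(x). -/
theorem finRotate_val_eq_ite {n : ℕ} (i : Fin n) :
    (finRotate n i).val = if i.val + 1 = n then 0 else i.val + 1 := by
  cases n with
  | zero => exact i.elim0
  | succ n =>
    rw [coe_finRotate]
    simp [Fin.ext_iff]

theorem halfIdx_val {k : ℕ} (j : Fin (2 * k)) : (halfIdx j).val = j.val / 2 := rfl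

theorem rhoD_injective (k : ℕ) : Function.Injective (rhoD k) := by
  intro x y h
  funext i
  have hi := congrFun h ⟨2 * i.val, by omega⟩
  have hidx : halfIdx (⟨2 * i.val, by omega⟩ : Fin (2 * k)) = i := by
    ext
    simp [halfIdx]
  simp only [rhoD, hidx, Nat.mul_mod_right, if_true, Prod.mk.injEq] at hi
  exact hi.1

/-- The permutation of the `2k` positions induced by the reversal of `[k]`: `j ↦ -3 - j` modulo
`2k`, with positions counted from zero. -/
def pairReversal {k : ℕ} (hk : 3 ≤ k) : Equiv.Perm (Fin (2 * k)) :=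
  Function.Involutive.toPerm
    (fun j => ⟨if j.val + 3 ≤ 2 * k then 2 * k - 3 - j.val else 4 * k - 3 - j.val,
      by have := j.isLt; split_ifs <;> omega⟩)
    (by
      intro j
      ext
      have := j.isLt
      dsimp only
      split_ifs <;> omega)

theorem pairReversal_val {k : ℕ} (hk : 3 ≤ k) (j : Fin (2 * k)) :
    (pairReversal hk j).val =
      if j.val + 3 ≤ 2 * k then 2 * k - 3 - j.val else 4 * k - 3 - j.val := rfl

theorem rhoD_permAct_finRotate {k : ℕ} (x : Fin k → ℝ) :
    rhoD k (permAct (finRotate k) x) =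
      permAct (finRotate (2 * k) * finRotate (2 * k)) (rhoD k x) := by
  funext j
  have hj := j.isLt
  have hval : (finRotate (2 * k) (finRotate (2 * k) j)).val =
      if j.val + 2 < 2 * k then j.val + 2 else j.val + 2 - 2 * k := by
    rw [finRotate_val_eq_ite, finRotate_val_eq_ite]
    split_ifs <;> omega
  have hidx : halfIdx (finRotate (2 * k) (finRotate (2 * k) j)) = finRotate k (halfIdx j) := by
    ext
    rw [finRotate_val_eq_ite, halfIdx_val, halfIdx_val, hval]
    split_ifs <;> omega
  have hpar : (finRotate (2 * k) (finRotate (2 * k) j)).val % 2 = j.val % 2 := by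
    rw [hval]
    split_ifs <;> omega
  simp only [rhoD, permAct, Equiv.Perm.mul_apply, hidx, hpar]

theorem rhoD_permAct_revPerm {k : ℕ} (hk : 3 ≤ k) (x : Fin k → ℝ) :
    rhoD k (permAct Fin.revPerm x) = permAct (pairReversal hk) (rhoD k x) := by
  funext j
  have hj := j.isLt
  have hidx : halfIdx (pairReversal hk j) = Fin.rev (finRotate k (halfIdx j)) := by
    ext
    rw [Fin.val_rev, finRotate_val_eq_ite, halfIdx_val, halfIdx_val, pairReversal_val]
    split_ifs <;> omega
  have hrot : finRotate k (Fin.rev (finRotate k (halfIdx j))) = Fin.rev (halfIdx j) := by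
    ext
    rw [finRotate_val_eq_ite, Fin.val_rev, Fin.val_rev, finRotate_val_eq_ite, halfIdx_val]
    split_ifs <;> omega
  have hpar : (pairReversal hk j).val % 2 = 1 - j.val % 2 := by
    rw [pairReversal_val]
    split_ifs <;> omega
  simp only [rhoD, permAct, Fin.revPerm_apply, hidx, hrot, hpar]
  rcases Nat.mod_two_eq_zero_or_one j.val with h | h <;> simp [h]

/-- `ρ_D` is injective, and for every `h ∈ D_k` there is `g ∈ S_{2k}` with
`ρ_D(h·x) = g·ρ_D(x)`. -/
theorem stmt_7 (k : ℕ) (hk : 3 ≤ k) :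
    Function.Injective (rhoD k) ∧
    ∀ h ∈ Dsub k, ∀ x : Fin k → ℝ, ∃ g : Equiv.Perm (Fin (2 * k)),
      rhoD k (permAct h x) = permAct g (rhoD k x) := by
  refine ⟨rhoD_injective k, fun h hh => ?_⟩
  induction hh using Subgroup.closure_induction with
  | mem h hmem =>
    rcases hmem with rfl | rfl
    · exact fun x => ⟨_, rhoD_permAct_finRotate x⟩
    · exact fun x => ⟨_, rhoD_permAct_revPerm hk x⟩
  | one => exact fun x => ⟨1, rfl⟩
  | mul a b _ _ iha ihb =>
    intro x
    obtain ⟨g, hg⟩ := iha x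
    obtain ⟨g', hg'⟩ := ihb (permAct a x)
    refine ⟨g * g', ?_⟩
    rw [hg] at hg'
    exact hg'
  | inv a _ ih =>
    intro x
    obtain ⟨g, hg⟩ := ih (permAct a⁻¹ x)
    have hx : permAct a (permAct a⁻¹ x) = x := by
      funext i
      simp [permAct]
    rw [hx] at hg
    refine ⟨g⁻¹, ?_⟩
    rw [hg]
    funext i
    simp [permAct]
end

section
/- Let k ≥ 3, x ∈ X_k and g ∈ S_{2k} (acting on (ℝ²)^{2k} by permuting the 2k pair-coordinates). If g·ρ_D(x) ∈ ρ_D(X_k), then there exists h ∈ D_k such that g·ρ_D(x) = ρ_D(h·x). -/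
section

open scoped Fin.NatCast Fin.CommRing

lemma finRotate_pow_val_apply {n : ℕ} (c i : Fin (n + 1)) :
    (finRotate (n + 1) ^ c.val) i = i + c := by
  have key (m : ℕ) : (finRotate (n + 1) ^ m) i = i + (m : Fin (n + 1)) := by
    induction m with
    | zero => simp
    | succ m ih => rw [pow_succ', Equiv.Perm.mul_apply, ih, finRotate_apply, Nat.cast_succ, add_assoc]
  rw [key, Fin.cast_val_eq_self]

lemma fin_rev_eq_neg_sub_one {n : ℕ} (i : Fin (n + 1)) : Fin.rev i = -i - 1 := by
  rw [← Fin.last_sub, ← Fin.neg_last n]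
  abel

/-- A permutation of the cycle `Fin (n + 3)` preserving adjacency is a rotation or a reflection. -/
lemma rotation_or_reflection_of_adjacent {n : ℕ} (h : Fin (n + 3) → Fin (n + 3))
    (hinj : Function.Injective h)
    (hadj : ∀ i, h (i + 1) = h i + 1 ∨ h i = h (i + 1) + 1) :
    (∀ i, h i = h 0 + i) ∨ (∀ i, h i = h 0 - i) := by
  have hne (i : Fin (n + 3)) : h (i + 1 + 1) ≠ h i := fun e => by
    have h2 : (1 : Fin (n + 3)) + 1 = 0 := by
      have := hinj e
      rwa [add_assoc, add_eq_left] at this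
    have h3 := congrArg Fin.val h2
    simp only [Fin.val_add, Fin.val_one, Fin.val_zero, Nat.mod_eq_of_lt (show 1 + 1 < n + 3 by omega)] at h3
    omega
  have hcast (i : Fin (n + 3)) : ((i.val : ℕ) : Fin (n + 3)) = i := Fin.cast_val_eq_self i
  rcases hadj 0 with h0 | h0
  · left
    have key (m : ℕ) : h ((m : Fin (n + 3)) + 1) = h m + 1 ∧ h m = h 0 + m := by
      induction m with
      | zero => simpa using h0
      | succ m ih =>
        push_cast
        refine ⟨(hadj _).resolve_right fun e => hne m ?_, by rw [ih.1, ih.2, add_assoc]⟩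
        exact add_right_cancel (e.symm.trans ih.1)
    intro i
    simpa only [hcast] using (key i.val).2
  · right
    have key (m : ℕ) : h m = h ((m : Fin (n + 3)) + 1) + 1 ∧ h m = h 0 - m := by
      induction m with
      | zero => simpa using h0
      | succ m ih =>
        push_cast
        refine ⟨(hadj _).resolve_left fun e => hne m (e.trans ih.1.symm), ?_⟩
        rw [eq_sub_of_add_eq ih.1.symm, ih.2, sub_sub]
    intro i
    simpa only [hcast] using (key i.val).2

end

/-- The tuple `y` is obtained from `x` by an adjacency-preserving map of indices whenever the entries
of `ρ_D(y)` are among those of `ρ_D(x)`. -/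
lemma exists_index_of_permAct_rhoD_eq {k : ℕ} {x y : Fin k → ℝ} {g : Equiv.Perm (Fin (2 * k))}
    (hy : rhoD k y = permAct g (rhoD k x)) (i : Fin k) :
    ∃ a b, y i = x a ∧ y (finRotate k i) = x b ∧ (b = finRotate k a ∨ a = finRotate k b) := by
  have hi : 2 * i.val < 2 * k := by omega
  have e := congrFun hy ⟨2 * i.val, hi⟩
  have hidx : halfIdx (⟨2 * i.val, hi⟩ : Fin (2 * k)) = i := by
    ext
    simp [halfIdx]
  simp only [permAct, rhoD, hidx, Nat.mul_mod_right, if_true] at e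
  split_ifs at e with hpar
  · exact ⟨_, _, congrArg Prod.fst e, congrArg Prod.snd e, Or.inl rfl⟩
  · exact ⟨_, _, congrArg Prod.fst e, congrArg Prod.snd e, Or.inr rfl⟩

/-- If `x ∈ X_k`, `g ∈ S_{2k}` and `g·ρ_D(x) ∈ ρ_D(X_k)`, then
`g·ρ_D(x) = ρ_D(h·x)` for some `h ∈ D_k`. -/
theorem stmt_8 (k : ℕ) (hk : 3 ≤ k) (x : Fin k → ℝ) (hx : x ∈ Xset k)
    (g : Equiv.Perm (Fin (2 * k)))
    (hmem : permAct g (rhoD k x) ∈ rhoD k '' Xset k) :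
    ∃ h ∈ Dsub k, permAct g (rhoD k x) = rhoD k (permAct h x) := by
  obtain ⟨y, hyX, hy⟩ := hmem
  obtain ⟨n, rfl⟩ : ∃ n, k = n + 3 := ⟨k - 3, by omega⟩
  have hidx := exists_index_of_permAct_rhoD_eq hy
  choose h h' hh hh' hadj using hidx
  have hinj : Function.Injective h := fun i j e => hyX.2 (by rw [hh, hh, e])
  have hsucc (i : Fin (n + 3)) : h' i = h (i + 1) := by
    apply hx.2
    rw [← hh', ← hh, finRotate_apply]
  have hadj' (i : Fin (n + 3)) : h (i + 1) = h i + 1 ∨ h i = h (i + 1) + 1 := by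
    simpa only [hsucc, finRotate_apply] using hadj i
  have hrot : finRotate (n + 3) ∈ Dsub (n + 3) := Subgroup.subset_closure (by simp)
  have hrev : Fin.revPerm ∈ Dsub (n + 3) := Subgroup.subset_closure (by simp)
  suffices ∃ σ ∈ Dsub (n + 3), ∀ i, h i = σ i by
    obtain ⟨σ, hσ, hσh⟩ := this
    refine ⟨σ, hσ, ?_⟩
    rw [← hy]
    congr 1
    funext i
    rw [hh, hσh, permAct]
  rcases rotation_or_reflection_of_adjacent h hinj hadj' with hc | hc
  · refine ⟨finRotate (n + 3) ^ (h 0).val, pow_mem hrot _, fun i => ?_⟩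
    rw [finRotate_pow_val_apply, hc, add_comm i]
  · refine ⟨finRotate (n + 3) ^ (h 0 + 1).val * Fin.revPerm,
      mul_mem (pow_mem hrot _) hrev, fun i => ?_⟩
    rw [Equiv.Perm.mul_apply, finRotate_pow_val_apply, hc, Fin.revPerm_apply,
      fin_rev_eq_neg_sub_one]
    abel
end

section
/- Let k ≥ 3. There exists a Z_k-invariant function ψ : ℝ^k → ℝ such that for every real k × k matrix M and every S_k-invariant function φ : ℝ^k → ℝ, it is not the case that ψ(x) = φ(Mx) for all x ∈ ℝ^k. In other words, ψ does not belong to the class A_k = {φ ∘ M : M a real k × k matrix, φ an S_k-invariant function ℝ^k → ℝ}. -/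
/-- Tuples related by a permutation in the subgroup `H`. -/
def permSetoid {ι : Type*} (α : Type*) (H : Subgroup (Equiv.Perm ι)) : Setoid (ι → α) where
  r x y := ∃ h ∈ H, y = permAct h x
  iseqv :=
    { refl := fun _ => ⟨1, H.one_mem, rfl⟩
      symm := by
        rintro x _ ⟨h, hh, rfl⟩
        exact ⟨h⁻¹, H.inv_mem hh, funext fun i => by simp [permAct]⟩
      trans := by
        rintro x _ _ ⟨h, hh, rfl⟩ ⟨h', hh', rfl⟩
        exact ⟨h * h', H.mul_mem hh hh', rfl⟩ }

/-- A finite power of the reals embeds, as a set, into the reals. -/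
theorem exists_injective_pi_real (ι : Type) [Finite ι] :
    ∃ f : (ι → ℝ) → ℝ, Function.Injective f := by
  have h : Cardinal.mk (ι → ℝ) ≤ Cardinal.mk ℝ := by
    rw [← Cardinal.power_def, Cardinal.mk_real]
    calc Cardinal.continuum ^ Cardinal.mk ι ≤ Cardinal.continuum ^ Cardinal.aleph0 :=
          Cardinal.power_le_power_left Cardinal.continuum_ne_zero Cardinal.mk_le_aleph0
      _ = Cardinal.continuum := Cardinal.continuum_power_aleph0
  obtain ⟨f⟩ := h
  exact ⟨f, f.injective⟩

/-- A real-valued complete invariant of the orbits of a group of coordinate permutations. -/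
theorem exists_orbit_separating {ι : Type} [Finite ι] (H : Subgroup (Equiv.Perm ι)) :
    ∃ ψ : (ι → ℝ) → ℝ, ∀ x y, ψ x = ψ y ↔ ∃ h ∈ H, y = permAct h x := by
  obtain ⟨f, hf⟩ := exists_injective_pi_real ι
  refine ⟨fun x => f (Quotient.mk (permSetoid ℝ H) x).out, fun x y => ?_⟩
  rw [hf.eq_iff, Quotient.out_inj, Quotient.eq]
  rfl

/-- If a linear map agrees at each point with a member of a finite family of linear maps,
then it is equal to one of them. -/
theorem LinearMap.exists_eq_of_forall_exists_apply_eq {K V W ι : Type*} [Field K] [Infinite K]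
    [AddCommGroup V] [Module K V] [AddCommGroup W] [Module K W] [Finite ι]
    (A : V →ₗ[K] W) (B : ι → V →ₗ[K] W) (h : ∀ x, ∃ i, A x = B i x) :
    ∃ i, A = B i := by
  obtain ⟨i, hi⟩ := Subspace.exists_eq_top_of_iUnion_eq_univ
    (p := fun i => LinearMap.eqLocus A (B i))
    (Set.eq_univ_of_forall fun x => Set.mem_iUnion.2 (h x))
  exact ⟨i, LinearMap.eqLocus_eq_top.1 hi⟩

/-- For `k ≥ 3` there is a `Z_k`-invariant function `ψ : ℝ^k → ℝ` that cannot be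
written as `φ ∘ M` with `M` a real `k × k` matrix and `φ` `S_k`-invariant. -/
theorem stmt_15 (k : ℕ) (hk : 3 ≤ k) :
    ∃ ψ : (Fin k → ℝ) → ℝ,
      (∀ h ∈ Zsub k, ∀ x : Fin k → ℝ, ψ (permAct h x) = ψ x) ∧
      ∀ (M : Matrix (Fin k) (Fin k) ℝ) (φ : (Fin k → ℝ) → ℝ),
        (∀ (g : Equiv.Perm (Fin k)) (y : Fin k → ℝ), φ (permAct g y) = φ y) →
        ¬ (∀ x : Fin k → ℝ, ψ x = φ (M.mulVec x)) := by
  obtain ⟨ψ, hψ⟩ := exists_orbit_separating (Zsub k)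
  refine ⟨ψ, fun h hh x => ((hψ x _).2 ⟨h, hh, rfl⟩).symm, fun M φ hφ hM => ?_⟩
  have hinj : Function.Injective M.mulVecLin := by
    rw [injective_iff_map_eq_zero]
    intro v hv
    have h0 : ψ 0 = ψ v := by
      rw [hM, hM, Matrix.mulVec_zero]
      exact congrArg φ hv.symm
    obtain ⟨h, -, rfl⟩ := (hψ 0 v).1 h0
    rfl
  have hsurj : Function.Surjective M.mulVecLin := LinearMap.injective_iff_surjective.1 hinj
  have hconj (g : Equiv.Perm (Fin k)) :
      ∃ h ∈ Zsub k, ∀ x, permAct g (M.mulVec x) = M.mulVec (permAct h x) := by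
    obtain ⟨h, hh⟩ := LinearMap.exists_eq_of_forall_exists_apply_eq
      (LinearMap.funLeft ℝ ℝ g ∘ₗ M.mulVecLin)
      (fun h : Zsub k => M.mulVecLin ∘ₗ LinearMap.funLeft ℝ ℝ (h : Equiv.Perm (Fin k)))
      (fun x => by
        obtain ⟨x', hx'⟩ := hsurj (permAct g (M.mulVec x))
        have hx : ψ x = ψ x' := by
          rw [hM, hM, ← hφ g]
          exact congrArg φ hx'.symm
        obtain ⟨h, hh, rfl⟩ := (hψ x x').1 hx
        exact ⟨⟨h, hh⟩, hx'.symm⟩)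
    exact ⟨h, h.2, fun x => LinearMap.congr_fun hh x⟩
  have hcomm (g₁ g₂ : Equiv.Perm (Fin k)) : g₁ * g₂ = g₂ * g₁ := by
    obtain ⟨h₁, hh₁, e₁⟩ := hconj g₁
    obtain ⟨h₂, hh₂, e₂⟩ := hconj g₂
    have hh : h₁ * h₂ = h₂ * h₁ := by
      obtain ⟨m, rfl⟩ := Subgroup.mem_zpowers_iff.1 hh₁
      obtain ⟨n, rfl⟩ := Subgroup.mem_zpowers_iff.1 hh₂
      exact zpow_mul_comm _ m n
    obtain ⟨x, hx⟩ := hsurj fun i => ((i : ℕ) : ℝ)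
    have e : permAct (g₁ * g₂) (M.mulVec x) = permAct (g₂ * g₁) (M.mulVec x) :=
      calc permAct (g₁ * g₂) (M.mulVec x) = permAct g₂ (permAct g₁ (M.mulVec x)) := rfl
        _ = M.mulVec (permAct (h₁ * h₂) x) := by rw [e₁, e₂]; rfl
        _ = M.mulVec (permAct (h₂ * h₁) x) := by rw [hh]
        _ = permAct g₁ (permAct g₂ (M.mulVec x)) := by rw [e₂, e₁]; rfl
    ext i
    have ei := congrFun e i
    rw [show M.mulVec x = _ from hx] at ei
    exact Nat.cast_injective ei
  let a : Fin k := ⟨0, by omega⟩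
  let b : Fin k := ⟨1, by omega⟩
  let c : Fin k := ⟨2, by omega⟩
  have hac : a ≠ c := by simp [a, c]
  have hab : a ≠ b := by simp [a, b]
  have hbc : b ≠ c := by simp [b, c]
  have e := Equiv.congr_fun (hcomm (Equiv.swap a b) (Equiv.swap b c)) a
  rw [Equiv.Perm.mul_apply, Equiv.Perm.mul_apply, Equiv.swap_apply_of_ne_of_ne hab hac,
    Equiv.swap_apply_left, Equiv.swap_apply_left] at e
  exact hbc e
end
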